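/- Let ℒ be a subspace lattice on a complex Banach space X and 𝒜 = alg ℒ. Suppose there exists a nontrivial idempotent P ∈ 𝒜 such that ran(P) ∈ ℒ and P B(X)(I − P) ⊆ 𝒜. If a linear map δ : 𝒜 → B(X) is Jordan derivable at some C ∈ 𝒜, then δ is a derivation, i.e. δ(AB) = δ(A)B + Aδ(B) for all A, B ∈ 𝒜. In particular, every C ∈ 𝒜 is a Jordan all-derivable point. -/

import Mathlib

set_option synthInstance.maxHeartbeats 1000000
set_option maxHeartbeats 1000000

/-- The algebra `alg ℒ` of all bounded operators leaving every member of `ℒ` invariant. -/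
def algLat {X : Type*} [NormedAddCommGroup X] [NormedSpace ℂ X]
    (ℒ : Set (Submodule ℂ X)) : Subalgebra ℂ (X →L[ℂ] X) where
  carrier := {T | ∀ K ∈ ℒ, ∀ x ∈ K, T x ∈ K}
  mul_mem' := by
    intro T S hT hS K hK x hx
    exact hT K hK _ (hS K hK x hx)
  add_mem' := by
    intro T S hT hS K hK x hx
    exact K.add_mem (hT K hK x hx) (hS K hK x hx)
  one_mem' := by
    intro K hK x hx
    exact hx
  algebraMap_mem' := by
    intro c K hK x hx
    show (algebraMap ℂ (X →L[ℂ] X) c) x ∈ K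
    rw [Algebra.algebraMap_eq_smul_one]
    exact K.smul_mem c hx
  zero_mem' := by
    intro K hK x hx
    exact K.zero_mem

/-- The failure of a linear map `δ` to be Jordan derivable at a pair of elements. -/
def jordanDefect {R : Type*} [Ring R] [Algebra ℂ R] (δ : R →ₗ[ℂ] R) : R →ₗ[ℂ] R →ₗ[ℂ] R :=
  LinearMap.mk₂ ℂ (fun a b => δ (a * b + b * a) - (δ a * b + a * δ b + δ b * a + b * δ a))
    (by intro a b c; simp only [mul_add, add_mul, map_add]; abel)
    (by intro k a b; simp only [smul_mul_assoc, mul_smul_comm, map_add, map_smul]; module)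
    (by intro a b c; simp only [mul_add, add_mul, map_add]; abel)
    (by intro k a b; simp only [smul_mul_assoc, mul_smul_comm, map_add, map_smul]; module)

theorem mul_eq_zero_of_orthogonal {R : Type*} [Ring R] {s t e f : R} (hs : s * e = s) (ht : f * t = t)
    (hef : e * f = 0) : s * t = 0 := by
  rw [← hs, ← ht, mul_assoc, ← mul_assoc e, hef, zero_mul, mul_zero]

section Peirce

variable {R : Type*} [Ring R] [Algebra ℂ R]

theorem jordanDefect_apply (δ : R →ₗ[ℂ] R) (a b : R) :
    jordanDefect δ a b = δ (a * b + b * a) - (δ a * b + a * δ b + δ b * a + b * δ a) := rfl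

theorem jordanDefect_comm (δ : R →ₗ[ℂ] R) (a b : R) :
    jordanDefect δ a b = jordanDefect δ b a := by
  simp only [jordanDefect_apply, add_comm (b * a)]; abel

theorem eq_zero_of_add_self {x : R} (h : x + x = 0) : x = 0 := by
  have h2 : (2 : ℂ) • x = 0 := by rw [two_smul, h]
  exact (smul_eq_zero_iff_right two_ne_zero).1 h2

theorem mul_eq_zero_of_anticommute {e r : R} (he : e * e = e) (h : r * e + e * r = 0) :
    r * e = 0 ∧ e * r = 0 := by
  have h1 := congrArg (e * · * e) h
  simp only [mul_add, add_mul, mul_assoc, he, mul_zero, zero_mul] at h1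
  rw [← mul_assoc e e, he] at h1
  have h2 : e * (r * e) = 0 := eq_zero_of_add_self h1
  have h3 := congrArg (e * ·) h
  simp only [mul_add, h2, ← mul_assoc e e, he, mul_zero, zero_add] at h3
  rw [h3, add_zero] at h
  exact ⟨h, h3⟩

/-- Complementary idempotents `P`, `Q` which triangularize a subalgebra `S` of a prime algebra. -/
structure TriangularPair (S : Subalgebra ℂ R) (P Q : R) : Prop where
  add_eq : P + Q = 1
  PP : P * P = P
  P_ne : P ≠ 0
  Q_ne : Q ≠ 0
  P_mem : P ∈ S
  lower : ∀ s ∈ S, Q * s * P = 0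
  upper : ∀ r, P * r * Q ∈ S
  prime : ∀ s t : R, (∀ r, s * r * t = 0) → s = 0 ∨ t = 0
  unit : ∀ s ∈ S, ∃ k : ℂ, ∃ t ∈ S, (s + k • (1 : R)) * t = 1 ∧ t * (s + k • (1 : R)) = 1

namespace TriangularPair

variable {S : Subalgebra ℂ R} {P Q : R}

theorem Q_eq (h : TriangularPair S P Q) : Q = 1 - P := eq_sub_of_add_eq' h.add_eq

theorem PQ (h : TriangularPair S P Q) : P * Q = 0 := by
  rw [h.Q_eq, mul_sub, mul_one, h.PP, sub_self]

theorem QP (h : TriangularPair S P Q) : Q * P = 0 := by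
  rw [h.Q_eq, sub_mul, one_mul, h.PP, sub_self]

theorem QQ (h : TriangularPair S P Q) : Q * Q = Q := by
  nth_rw 1 [h.Q_eq]; rw [sub_mul, one_mul, h.PQ, sub_zero]

theorem Q_mem (h : TriangularPair S P Q) : Q ∈ S := by
  rw [h.Q_eq]; exact S.sub_mem S.one_mem h.P_mem

theorem PP_mul (h : TriangularPair S P Q) (r : R) : P * (P * r) = P * r := by
  rw [← mul_assoc, h.PP]

theorem PQ_mul (h : TriangularPair S P Q) (r : R) : P * (Q * r) = 0 := by
  rw [← mul_assoc, h.PQ, zero_mul]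

theorem QP_mul (h : TriangularPair S P Q) (r : R) : Q * (P * r) = 0 := by
  rw [← mul_assoc, h.QP, zero_mul]

theorem QQ_mul (h : TriangularPair S P Q) (r : R) : Q * (Q * r) = Q * r := by
  rw [← mul_assoc, h.QQ]

theorem peirce (h : TriangularPair S P Q) (r : R) :
    r = P * r * P + P * r * Q + Q * r * P + Q * r * Q := by
  calc r = (P + Q) * r * (P + Q) := by rw [h.add_eq, one_mul, mul_one]
    _ = _ := by noncomm_ring

theorem eq_zero_of_mul_upper (h : TriangularPair S P Q) {s : R} (hs : s * P = s)
    (hz : ∀ z, P * z = z → z * Q = z → s * z = 0) : s = 0 := by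
  refine (h.prime s Q fun r => ?_).resolve_right h.Q_ne
  have := hz (P * r * Q) (by rw [mul_assoc, h.PP_mul]) (by rw [mul_assoc, h.QQ])
  rwa [← mul_assoc, ← mul_assoc, hs] at this

theorem eq_zero_of_upper_mul (h : TriangularPair S P Q) {s : R} (hs : Q * s = s)
    (hz : ∀ z, P * z = z → z * Q = z → z * s = 0) : s = 0 := by
  refine (h.prime P s fun r => ?_).resolve_left h.P_ne
  have := hz (P * r * Q) (by rw [mul_assoc, h.PP_mul]) (by rw [mul_assoc, h.QQ])
  rwa [mul_assoc, hs] at this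

theorem upper_mem (h : TriangularPair S P Q) {z : R} (h1 : P * z = z) (h2 : z * Q = z) :
    z ∈ S := by
  have := h.upper z
  rwa [h1, h2] at this

/-- A lower corner element `g` with `z * g * z = 0` for all upper corner elements vanishes. -/
theorem lower_eq_zero (h : TriangularPair S P Q) {g : R} (hg1 : Q * g = g) (hg2 : g * P = g)
    (hz : ∀ z, P * z = z → z * Q = z → z * g * z = 0) : g = 0 := by
  have pol : ∀ x y, P * x = x → x * Q = x → P * y = y → y * Q = y →
      x * g * y = - (y * g * x) := by
    intro x y hx1 hx2 hy1 hy2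
    have h1 := hz (x + y) (by rw [mul_add, hx1, hy1]) (by rw [add_mul, hx2, hy2])
    have h2 := hz x hx1 hx2
    have h3 := hz y hy1 hy2
    simp only [add_mul, mul_add, h2, h3, zero_add, add_zero] at h1
    exact eq_neg_of_add_eq_zero_right h1
  refine h.eq_zero_of_mul_upper hg2 fun x hx1 hx2 => ?_
  have key : ∀ r, (x * g) * r * (g * x) = 0 := by
    intro r
    have hp := pol x (P * r * Q) hx1 hx2 (by rw [mul_assoc, h.PP_mul]) (by rw [mul_assoc, h.QQ])
    calc (x * g) * r * (g * x) = (x * (g * P)) * r * ((Q * g) * x) := by rw [hg1, hg2]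
      _ = (x * g * (P * r * Q)) * g * x := by noncomm_ring
      _ = - ((P * r * Q) * g * (x * g * x)) := by rw [hp]; noncomm_ring
      _ = 0 := by rw [hz x hx1 hx2]; simp
  rcases h.prime _ _ key with h0 | h0
  · refine h.eq_zero_of_upper_mul (by rw [← mul_assoc, hg1]) fun y hy1 hy2 => ?_
    rw [← mul_assoc, pol y x hy1 hy2 hx1 hx2, h0, zero_mul, neg_zero]
  · exact h0

theorem jordanDefect_factor (h : TriangularPair S P Q) {δ : R →ₗ[ℂ] R} {C : R} (hC : C ∈ S)
    (hδ : ∀ a ∈ S, ∀ b ∈ S, a * b = C → jordanDefect δ a b = 0)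
    {a f b e z : R} (ha : a ∈ S) (hf : f ∈ S) (hb : b ∈ S) (he : e ∈ S)
    (ha2 : a * P = a) (hf1 : P * f = f) (hb1 : Q * b = b)
    (he2 : e * Q = e) (haf : a * f = P) (heb : e * b = Q)
    (hz1 : P * z = z) (hz2 : z * Q = z) :
    jordanDefect δ (a + a * z + Q * C * e) (f * C - z * b + b) = 0 := by
  have hz := h.upper_mem hz1 hz2
  refine hδ _ (S.add_mem (S.add_mem ha (S.mul_mem ha hz)) (S.mul_mem (S.mul_mem h.Q_mem hC) he))
    _ (S.add_mem (S.sub_mem (S.mul_mem hf hC) (S.mul_mem hz hb)) hb) ?_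
  have hab : a * b = 0 := mul_eq_zero_of_orthogonal ha2 hb1 h.PQ
  have hzf : z * f = 0 := mul_eq_zero_of_orthogonal hz2 hf1 h.QP
  have hzz : z * z = 0 := mul_eq_zero_of_orthogonal hz2 hz1 h.QP
  have hef : e * f = 0 := mul_eq_zero_of_orthogonal he2 hf1 h.QP
  have hez : e * z = 0 := mul_eq_zero_of_orthogonal he2 hz1 h.QP
  have hQC : Q * C * Q = Q * C := by
    have := h.lower C hC
    calc Q * C * Q = Q * C * (P + Q) := by rw [mul_add, this, zero_add]
      _ = Q * C := by rw [h.add_eq, mul_one]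
  calc (a + a * z + Q * C * e) * (f * C - z * b + b)
      = (a * f) * C + a * b + a * (z * f) * C - a * (z * z) * b + Q * C * (e * f) * C
        - Q * C * (e * z) * b + Q * C * (e * b) := by noncomm_ring
    _ = P * C + Q * C := by rw [hab, hzf, hzz, hef, hez, haf, heb, hQC]; simp
    _ = C := by rw [← add_mul, h.add_eq, one_mul]

theorem jordanDefect_of_units (h : TriangularPair S P Q) {δ : R →ₗ[ℂ] R} {C : R} (hC : C ∈ S)
    (hδ : ∀ a ∈ S, ∀ b ∈ S, a * b = C → jordanDefect δ a b = 0)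
    {a f b e z : R} (ha : a ∈ S) (hf : f ∈ S) (hb : b ∈ S) (he : e ∈ S)
    (ha2 : a * P = a) (hf1 : P * f = f) (hb1 : Q * b = b)
    (he2 : e * Q = e) (haf : a * f = P) (heb : e * b = Q)
    (hz1 : P * z = z) (hz2 : z * Q = z) :
    jordanDefect δ a b = 0 ∧ jordanDefect δ (a * z) b = jordanDefect δ a (z * b) ∧
      jordanDefect δ (a * z) (z * b) = 0 := by
  have key : ∀ (μ ν : ℂ), ν ≠ 0 →
      jordanDefect δ (a + a * (μ • z) + Q * C * (ν⁻¹ • e)) (f * C - (μ • z) * (ν • b) + ν • b)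
        = 0 := by
    intro μ ν hν
    refine h.jordanDefect_factor hC hδ ha hf (S.smul_mem hb ν) (S.smul_mem he ν⁻¹) ha2 hf1
      ?_ ?_ haf ?_ ?_ ?_
    · rw [mul_smul_comm, hb1]
    · rw [smul_mul_assoc, he2]
    · rw [smul_mul_smul_comm, heb, inv_mul_cancel₀ hν, one_smul]
    · rw [mul_smul_comm, hz1]
    · rw [smul_mul_assoc, hz2]
  have k1 := key 0 1 one_ne_zero
  have k2 := key 0 (-1) (by norm_num)
  have k3 := key 0 2 two_ne_zero
  have k4 := key 1 1 one_ne_zero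
  have k5 := key (-1) 1 one_ne_zero
  have k6 := key 1 (-1) (by norm_num)
  simp only [mul_smul_comm, smul_mul_assoc, map_add, map_sub, map_smul, LinearMap.add_apply,
    LinearMap.smul_apply, zero_smul, one_smul, inv_one, mul_zero,
    zero_mul, map_zero, LinearMap.zero_apply]
    at k1 k2 k3 k4 k5 k6
  generalize jordanDefect δ a b = V1 at *
  generalize jordanDefect δ (a * z) b = V2 at *
  generalize jordanDefect δ a (z * b) = V3 at *
  generalize jordanDefect δ (a * z) (z * b) = V4 at *
  generalize jordanDefect δ a (f * C) = V5 at *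
  generalize jordanDefect δ (a * z) (f * C) = V6 at *
  generalize jordanDefect δ (Q * C * e) (f * C) = V7 at *
  generalize jordanDefect δ (Q * C * e) (z * b) = V8 at *
  generalize jordanDefect δ (Q * C * e) b = V9 at *
  have hV4 : V4 = 0 := by
    linear_combination (norm := module) k1 - (1 / 2 : ℂ) • k4 - (1 / 2 : ℂ) • k5
  refine ⟨?_, ?_, hV4⟩
  · linear_combination (norm := module) (2 / 3 : ℂ) • k3 - (1 / 2 : ℂ) • k1 - (1 / 6 : ℂ) • k2
  · linear_combination (norm := module) (1 / 2 : ℂ) • k4 - (1 / 2 : ℂ) • k6 - (1 / 2 : ℂ) • k1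
      + (1 / 2 : ℂ) • k2 + hV4

theorem exists_right_inverse_P (h : TriangularPair S P Q) {a : R} (ha : a ∈ S)
    (ha1 : P * a = a) (ha2 : a * P = a) :
    ∃ k : ℂ, ∃ f ∈ S, P * f = f ∧ (a + k • P) * f = P := by
  obtain ⟨k, t, ht, h1, -⟩ := h.unit a ha
  refine ⟨k, P * t * P, S.mul_mem (S.mul_mem h.P_mem ht) h.P_mem, ?_, ?_⟩
  · rw [mul_assoc, h.PP_mul]
  · have e1 : (a + k • P) * P = P * (a + k • (1 : R)) := by
      rw [add_mul, mul_add, ha1, ha2, smul_mul_assoc, mul_smul_comm, h.PP, mul_one]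
    rw [mul_assoc P, ← mul_assoc, e1, mul_assoc, ← mul_assoc _ t, h1, one_mul, h.PP]

theorem exists_left_inverse_Q (h : TriangularPair S P Q) {b : R} (hb : b ∈ S)
    (hb1 : Q * b = b) (hb2 : b * Q = b) :
    ∃ k : ℂ, ∃ e ∈ S, e * Q = e ∧ e * (b + k • Q) = Q := by
  obtain ⟨k, t, ht, -, h1⟩ := h.unit b hb
  refine ⟨k, Q * t * Q, S.mul_mem (S.mul_mem h.Q_mem ht) h.Q_mem, ?_, ?_⟩
  · rw [mul_assoc, h.QQ]
  · have e1 : Q * (b + k • Q) = (b + k • (1 : R)) * Q := by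
      rw [add_mul, mul_add, hb1, hb2, smul_mul_assoc, mul_smul_comm, h.QQ, one_mul]
    rw [mul_assoc, e1, ← mul_assoc, mul_assoc Q, h1, mul_one, h.QQ]

/-- Jordan derivability at one point forces these Jordan identities between Peirce corners. -/
theorem jordanDefect_corners (h : TriangularPair S P Q) {δ : R →ₗ[ℂ] R} {C : R} (hC : C ∈ S)
    (hδ : ∀ a ∈ S, ∀ b ∈ S, a * b = C → jordanDefect δ a b = 0)
    {a b z : R} (ha : a ∈ S) (hb : b ∈ S) (ha1 : P * a = a) (ha2 : a * P = a)
    (hb1 : Q * b = b) (hb2 : b * Q = b) (hz1 : P * z = z) (hz2 : z * Q = z) :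
    jordanDefect δ a b = 0 ∧ jordanDefect δ (a * z) b = jordanDefect δ a (z * b) ∧
      jordanDefect δ z z = 0 := by
  have hP := h.P_mem
  have hQ := h.Q_mem
  obtain ⟨k, f, hf, hf1, haf⟩ := h.exists_right_inverse_P ha ha1 ha2
  obtain ⟨l, e, he, he2, heb⟩ := h.exists_left_inverse_Q hb hb1 hb2
  have ha' : a + k • P ∈ S := S.add_mem ha (S.smul_mem hP k)
  have hb' : b + l • Q ∈ S := S.add_mem hb (S.smul_mem hQ l)
  have ha2' : (a + k • P) * P = a + k • P := by rw [add_mul, ha2, smul_mul_assoc, h.PP]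
  have hb1' : Q * (b + l • Q) = b + l • Q := by rw [mul_add, hb1, mul_smul_comm, h.QQ]
  obtain ⟨p1, p2, p3⟩ := h.jordanDefect_of_units hC hδ hP hP hQ hQ h.PP h.PP h.QQ h.QQ
    h.PP h.QQ hz1 hz2
  obtain ⟨q1, q2, -⟩ := h.jordanDefect_of_units hC hδ ha' hf hQ hQ ha2' hf1 h.QQ h.QQ
    haf h.QQ hz1 hz2
  obtain ⟨r1, r2, -⟩ := h.jordanDefect_of_units hC hδ hP hP hb' he h.PP h.PP hb1' he2
    h.PP heb hz1 hz2
  obtain ⟨s1, s2, -⟩ := h.jordanDefect_of_units hC hδ ha' hf hb' he ha2' hf1 hb1' he2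
    haf heb hz1 hz2
  simp only [add_mul, mul_add, smul_mul_assoc, mul_smul_comm, hz1, hz2, map_add, map_smul,
    LinearMap.add_apply, LinearMap.smul_apply] at p1 p2 p3 q1 q2 r1 r2 s1 s2
  refine ⟨?_, ?_, p3⟩
  · linear_combination (norm := module) s1 - k • r1 - l • q1 + (k * l) • p1
  · linear_combination (norm := module) s2 - k • r2 - l • q2 + (k * l) • p2


/-- Elements intertwining the two sides of the upper corner also intertwine with all operators
of the diagonal corners. -/
theorem intertwine_commute (h : TriangularPair S P Q) {u v : R} (hu2 : u * P = u)
    (hv1 : Q * v = v)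
    (huv : ∀ z, P * z = z → z * Q = z → u * z = z * v) (r : R) :
    u * (P * r * P) = P * r * P * u ∧ v * (Q * r * Q) = Q * r * Q * v := by
  constructor
  · refine sub_eq_zero.1 (h.eq_zero_of_mul_upper ?_ fun z hz1 hz2 => ?_)
    · rw [sub_mul, mul_assoc, mul_assoc _ P P, h.PP, mul_assoc _ u, hu2]
    · have h1 := huv (P * r * P * z) (by simp only [mul_assoc, h.PP_mul])
        (by rw [mul_assoc, hz2])
      rw [sub_mul, mul_assoc, h1, mul_assoc _ u, huv z hz1 hz2, mul_assoc _ z, sub_self]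
  · refine sub_eq_zero.1 (h.eq_zero_of_upper_mul ?_ fun z hz1 hz2 => ?_)
    · rw [mul_sub, ← mul_assoc, hv1]; simp only [mul_assoc, h.QQ_mul]
    · have h1 := huv (z * (Q * r * Q)) (by rw [← mul_assoc, hz1])
        (by simp only [mul_assoc, h.QQ])
      rw [mul_sub, ← mul_assoc, ← huv z hz1 hz2, mul_assoc, h1, mul_assoc, sub_self]

/-- If intertwining diagonal elements `u`, `v` satisfy `(u + v) * C = 0` with `C ≠ 0`, then both
vanish. -/
theorem intertwine_eq_zero (h : TriangularPair S P Q) {u v C : R} (hC : C ∈ S) (hC0 : C ≠ 0)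
    (hu1 : P * u = u) (hu2 : u * P = u) (hv1 : Q * v = v) (hv2 : v * Q = v)
    (huv : ∀ z, P * z = z → z * Q = z → u * z = z * v)
    (hJ : (u + v) * C + C * (u + v) = 0) : u = 0 ∧ v = 0 := by
  have hcomm := h.intertwine_commute hu2 hv1 huv
  have hQCP := h.lower C hC
  have hCe : C = P * C * P + P * C * Q + Q * C * Q := by
    conv_lhs => rw [h.peirce C, hQCP, add_zero]
  have huQ : u * Q = 0 := by rw [← hu2, mul_assoc, h.PQ, mul_zero]
  have hQu : Q * u = 0 := by rw [← hu1, ← mul_assoc, h.QP, zero_mul]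
  have hvP : v * P = 0 := by rw [← hv2, mul_assoc, h.QP, mul_zero]
  have hPv : P * v = 0 := by rw [← hv1, ← mul_assoc, h.PQ, zero_mul]
  have hy := huv (P * C * Q) (by simp only [mul_assoc, h.PP_mul]) (by simp only [mul_assoc, h.QQ])
  obtain ⟨hc, -⟩ := hcomm C
  obtain ⟨-, hd⟩ := hcomm C
  have hJ' : u * (P * C * P) + u * (P * C * P) + (u * (P * C * Q) + u * (P * C * Q))
      + (v * (Q * C * Q) + v * (Q * C * Q)) = 0 := by
    nth_rw 2 [hc]; nth_rw 2 [hd]; nth_rw 2 [hy]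
    rw [← hJ]
    conv_rhs => rw [hCe]
    simp only [mul_add, add_mul, ← mul_assoc, hu2, hv2, huQ, hvP, zero_add, add_zero]
    simp only [mul_assoc, hu1, hv1, hQu, hPv, mul_zero, zero_add, add_zero]
    abel
  have hsum : u * (P * C * P) + u * (P * C * Q) + v * (Q * C * Q) = 0 := by
    apply eq_zero_of_add_self
    rw [← hJ']; abel
  have hvd : v * (Q * C * Q) = 0 := by
    have := congrArg (Q * ·) hsum
    simpa only [mul_add, ← mul_assoc, hQu, hv1, zero_mul, zero_add, mul_zero] using this
  have huc : u * (P * C * P) + u * (P * C * Q) = 0 := by rwa [hvd, add_zero] at hsum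
  have huC : u * C = 0 := by
    rw [hCe, mul_add, mul_add, huc, zero_add, mul_assoc, ← mul_assoc, huQ, zero_mul]
  have hvC : v * C = 0 := by
    conv_lhs => rw [hCe]
    rw [mul_add, mul_add, hvd, mul_assoc P, ← mul_assoc v, hvP, mul_assoc P, ← mul_assoc v, hvP]
    simp
  have hu : u = 0 := by
    refine (h.prime u C fun r => ?_).resolve_right hC0
    have e1 : u * r * C = u * (P * r * P) * C + u * (P * r * Q) * C := by
      calc u * r * C = (u * P) * r * (P + Q) * C := by rw [h.add_eq, hu2, mul_one]
        _ = _ := by noncomm_ring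
    rw [e1, (hcomm r).1, huv (P * r * Q) (by simp only [mul_assoc, h.PP_mul])
      (by simp only [mul_assoc, h.QQ]), mul_assoc _ u, mul_assoc _ v, huC, hvC]
    simp
  refine ⟨hu, h.eq_zero_of_upper_mul hv1 fun z hz1 hz2 => ?_⟩
  rw [← huv z hz1 hz2, hu, zero_mul]

theorem diag_of_jordanDefect_P_Q (h : TriangularPair S P Q) {δ : R →ₗ[ℂ] R}
    (hPQ : jordanDefect δ P Q = 0) :
    P * δ Q * P = 0 ∧ Q * δ P * Q = 0 ∧ P * (δ P + δ Q) * Q = 0 ∧ Q * (δ P + δ Q) * P = 0 := by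
  rw [jordanDefect_apply, h.PQ, h.QP, add_zero, map_zero, zero_sub, neg_eq_zero] at hPQ
  have k : ∀ x y, x * (δ P * Q + P * δ Q + δ Q * P + Q * δ P) * y = 0 := by
    intro x y; rw [hPQ]; simp
  have k1 := k P P
  have k2 := k Q Q
  have k3 := k P Q
  have k4 := k Q P
  simp only [mul_add, add_mul, mul_assoc, h.PP, h.QQ, h.PQ, h.QP, h.PP_mul, h.PQ_mul, h.QP_mul,
    h.QQ_mul, mul_zero, add_zero, zero_add] at k1 k2 k3 k4 ⊢
  exact ⟨eq_zero_of_add_self k1, eq_zero_of_add_self k2, k3, by rwa [add_comm]⟩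

theorem intertwine_of_jordanDefect (h : TriangularPair S P Q) {δ : R →ₗ[ℂ] R}
    (hPQ : jordanDefect δ P Q = 0) {z : R} (hz1 : P * z = z) (hz2 : z * Q = z)
    (hz : jordanDefect δ z Q = jordanDefect δ P z) :
    P * δ P * P * z = z * (Q * δ Q * Q) := by
  obtain ⟨d1, d2, -, -⟩ := h.diag_of_jordanDefect_P_Q hPQ
  have hQz : Q * z = 0 := by rw [← hz1, ← mul_assoc, h.QP, zero_mul]
  have hzP : z * P = 0 := by rw [← hz2, mul_assoc, h.QP, mul_zero]
  rw [jordanDefect_apply, jordanDefect_apply, hz1, hz2, hQz, hzP, add_zero] at hz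
  have k := congrArg (fun t => P * t * Q) (sub_right_injective hz)
  have e1 : P * (δ Q * z) = 0 := by
    rw [← hz1, ← mul_assoc, ← mul_assoc, d1, zero_mul]
  have e2 : z * (δ P * Q) = 0 := by
    rw [← hz2, mul_assoc, ← mul_assoc Q, d2, mul_zero]
  simp only [mul_add, add_mul, mul_assoc, h.QQ, h.PQ, h.PP_mul, h.PQ_mul, mul_zero, add_zero,
    hz2] at k
  have hPz : ∀ t, P * (z * t) = z * t := fun t => by rw [← mul_assoc, hz1]
  have hzQ : ∀ t, z * (Q * t) = z * t := fun t => by rw [← mul_assoc, hz2]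
  simp only [hPz, e1, e2, mul_zero, add_zero] at k
  simp only [mul_assoc, hz1, hzQ]
  rw [add_comm] at k
  exact (add_right_cancel k).symm

/-- Jordan derivability at one point forces `δ` to be Jordan derivable at all pairs
consisting of the idempotent `P` and an upper corner element. -/
theorem jordanDefect_P_upper (h : TriangularPair S P Q) {δ : R →ₗ[ℂ] R} {C : R} (hC : C ∈ S)
    (hδ : ∀ a ∈ S, ∀ b ∈ S, a * b = C → jordanDefect δ a b = 0)
    {z : R} (hz1 : P * z = z) (hz2 : z * Q = z) : jordanDefect δ P z = 0 := by
  have hcor : ∀ z, P * z = z → z * Q = z → jordanDefect δ P Q = 0 ∧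
      jordanDefect δ z Q = jordanDefect δ P z := by
    intro z hz1 hz2
    have := h.jordanDefect_corners hC hδ h.P_mem h.Q_mem h.PP h.PP h.QQ h.QQ hz1 hz2
    rw [hz1, hz2] at this
    exact ⟨this.1, this.2.1⟩
  by_cases hC0 : C = 0
  · rw [jordanDefect_comm]
    refine hδ z (h.upper_mem hz1 hz2) P h.P_mem ?_
    rw [hC0, ← hz2, mul_assoc, h.QP, mul_zero]
  obtain ⟨hPQ, hzz⟩ := hcor z hz1 hz2
  obtain ⟨d1, d2, d3, d4⟩ := h.diag_of_jordanDefect_P_Q hPQ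
  have h1 : δ 1 = P * δ P * P + Q * δ Q * Q := by
    have e : δ 1 = δ P + δ Q := by rw [← map_add, h.add_eq]
    rw [e, h.peirce (δ P + δ Q), d3, d4]
    simp only [mul_add, add_mul, d1, d2]
    simp
  have hJ := hδ 1 S.one_mem C hC (one_mul C)
  have one_defect : ∀ r, jordanDefect δ 1 r = - (δ 1 * r + r * δ 1) := by
    intro r
    rw [jordanDefect_apply, one_mul, mul_one, map_add, one_mul, mul_one]; abel
  rw [one_defect, neg_eq_zero, h1] at hJ
  obtain ⟨hu, hv⟩ := h.intertwine_eq_zero hC hC0 (by simp only [mul_assoc, h.PP_mul])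
    (by simp only [mul_assoc, h.PP]) (by simp only [mul_assoc, h.QQ_mul])
    (by simp only [mul_assoc, h.QQ])
    (fun z hz1 hz2 => h.intertwine_of_jordanDefect hPQ hz1 hz2 (hcor z hz1 hz2).2) hJ
  have hz1' := one_defect z
  rw [h1, hu, hv, ← h.add_eq, map_add, LinearMap.add_apply, jordanDefect_comm δ Q, hzz] at hz1'
  apply eq_zero_of_add_self
  rw [hz1']; simp

/-- A linear map killing both idempotents and Jordan derivable on the Peirce corners is a
derivation. -/
theorem derivation_of_map_idempotents_eq_zero (h : TriangularPair S P Q) {δ : R →ₗ[ℂ] R}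
    (hδP : δ P = 0) (hδQ : δ Q = 0)
    (hab : ∀ a ∈ S, ∀ b ∈ S, P * a = a → a * P = a → Q * b = b → b * Q = b →
      jordanDefect δ a b = 0)
    (haz : ∀ a ∈ S, ∀ z, P * a = a → a * P = a → P * z = z → z * Q = z → jordanDefect δ a z = 0)
    (hzb : ∀ b ∈ S, ∀ z, Q * b = b → b * Q = b → P * z = z → z * Q = z → jordanDefect δ z b = 0)
    (hzz : ∀ z, P * z = z → z * Q = z → jordanDefect δ z z = 0)
    {s t : R} (hs : s ∈ S) (ht : t ∈ S) : δ (s * t) = δ s * t + s * δ t := by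
  have dz0 : ∀ z, P * z = z → z * Q = z → δ z = P * δ z + δ z * P := by
    intro z hz1 hz2
    have k := haz P h.P_mem z h.PP h.PP hz1 hz2
    have hzP : z * P = 0 := mul_eq_zero_of_orthogonal hz2 h.PP h.QP
    rw [jordanDefect_apply, hδP, hz1, hzP, zero_mul, mul_zero, zero_add, add_zero, add_zero,
      sub_eq_zero] at k
    exact k
  have dg : ∀ z, P * z = z → z * Q = z → Q * δ z = 0 := by
    intro z hz1 hz2
    have offdiag : ∀ z, P * z = z → z * Q = z → P * δ z * P = 0 ∧ Q * δ z * Q = 0 := by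
      intro z hz1 hz2
      have k1 := congrArg (P * · * P) (dz0 z hz1 hz2)
      have k2 := congrArg (Q * · * Q) (dz0 z hz1 hz2)
      simp only [mul_add, add_mul, mul_assoc, h.PP, h.PQ, h.PP_mul, h.QP_mul, mul_zero,
        zero_add] at k1 k2 ⊢
      exact ⟨by simpa using k1, k2⟩
    have gmul : ∀ y, P * y = y → y * Q = y → Q * δ y * P * y = 0 := by
      intro y hy1 hy2
      have hyy : y * y = 0 := mul_eq_zero_of_orthogonal hy2 hy1 h.QP
      have hQy : ∀ t, Q * (y * t) = 0 := fun t => by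
        rw [← hy1, ← mul_assoc, ← mul_assoc, h.QP, zero_mul, zero_mul]
      have k := hzz y hy1 hy2
      rw [jordanDefect_apply, hyy, add_zero, map_zero, zero_sub, neg_eq_zero] at k
      have k' := congrArg (Q * ·) k
      simp only [mul_add, hQy, add_zero, mul_zero] at k'
      rw [mul_assoc, hy1, mul_assoc]
      exact eq_zero_of_add_self k'
    have hg : Q * δ z * P = 0 := by
      refine h.lower_eq_zero (by simp only [mul_assoc, h.QQ_mul]) (by simp only [mul_assoc, h.PP])
        fun y hy1 hy2 => ?_
      have k := hzz (z + y) (by rw [mul_add, hz1, hy1]) (by rw [add_mul, hz2, hy2])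
      simp only [map_add, LinearMap.add_apply, hzz z hz1 hz2, hzz y hy1 hy2, zero_add,
        add_zero, jordanDefect_comm δ y z] at k
      replace k := eq_zero_of_add_self k
      have hzy : z * y = 0 := mul_eq_zero_of_orthogonal hz2 hy1 h.QP
      have hyz : y * z = 0 := mul_eq_zero_of_orthogonal hy2 hz1 h.QP
      rw [jordanDefect_apply, hzy, hyz, add_zero, map_zero, zero_sub, neg_eq_zero] at k
      have hyy : y * y = 0 := mul_eq_zero_of_orthogonal hy2 hy1 h.QP
      have e : z * (δ y * y) = 0 := by
        have e' := gmul y hy1 hy2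
        rw [mul_assoc, hy1, mul_assoc] at e'
        rw [← hz2, mul_assoc, e', mul_zero]
      have k' := congrArg (· * y) k
      simp only [add_mul, mul_assoc, hyy, hzy, e, mul_zero, zero_mul, zero_add] at k'
      have hyQ : ∀ t, y * (Q * t) = y * t := fun t => by rw [← mul_assoc, hy2]
      simpa only [mul_assoc, hyQ, hy1] using k'
    calc Q * δ z = Q * δ z * P + Q * δ z * Q := by rw [← mul_add, h.add_eq, mul_one]
      _ = 0 := by rw [hg, (offdiag z hz1 hz2).2, add_zero]
  have dz1 : ∀ z, P * z = z → z * Q = z → P * δ z = δ z := by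
    intro z hz1 hz2
    have e : P * δ z + Q * δ z = δ z := by rw [← add_mul, h.add_eq, one_mul]
    rwa [dg z hz1 hz2, add_zero] at e
  have dz2 : ∀ z, P * z = z → z * Q = z → δ z * Q = δ z := by
    intro z hz1 hz2
    have k := dz0 z hz1 hz2
    rw [dz1 z hz1 hz2, left_eq_add] at k
    have e : δ z * P + δ z * Q = δ z := by rw [← mul_add, h.add_eq, mul_one]
    rwa [k, zero_add] at e
  have da : ∀ a ∈ S, P * a = a → a * P = a → P * δ a = δ a ∧ δ a * P = δ a := by
    intro a ha ha1 ha2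
    have k := hab a ha Q h.Q_mem ha1 ha2 h.QQ h.QQ
    have haQ : a * Q = 0 := mul_eq_zero_of_orthogonal ha2 h.QQ h.PQ
    have hQa : Q * a = 0 := mul_eq_zero_of_orthogonal h.QQ ha1 h.QP
    rw [jordanDefect_apply, haQ, hQa, hδQ, mul_zero, zero_mul, add_zero, add_zero, add_zero, map_zero,
      zero_sub, neg_eq_zero] at k
    obtain ⟨k1, k2⟩ := mul_eq_zero_of_anticommute h.QQ k
    constructor
    · rw [← sub_eq_zero, ← neg_eq_zero, ← k2, h.Q_eq]; noncomm_ring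
    · rw [← sub_eq_zero, ← neg_eq_zero, ← k1, h.Q_eq]; noncomm_ring
  have db : ∀ b ∈ S, Q * b = b → b * Q = b → Q * δ b = δ b ∧ δ b * Q = δ b := by
    intro b hb hb1 hb2
    have k := hab P h.P_mem b hb h.PP h.PP hb1 hb2
    have hbP : b * P = 0 := mul_eq_zero_of_orthogonal hb2 h.PP h.QP
    have hPb : P * b = 0 := mul_eq_zero_of_orthogonal h.PP hb1 h.PQ
    rw [jordanDefect_apply, hbP, hPb, hδP, mul_zero, zero_mul, add_zero, zero_add, map_zero,
      zero_sub, neg_eq_zero, add_zero, add_comm] at k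
    obtain ⟨k1, k2⟩ := mul_eq_zero_of_anticommute h.PP k
    constructor
    · rw [← sub_eq_zero, ← neg_eq_zero, ← k2, h.Q_eq]; noncomm_ring
    · rw [← sub_eq_zero, ← neg_eq_zero, ← k1, h.Q_eq]; noncomm_ring
  have Eaz : ∀ a ∈ S, ∀ z, P * a = a → a * P = a → P * z = z → z * Q = z →
      δ (a * z) = δ a * z + a * δ z := by
    intro a ha z ha1 ha2 hz1 hz2
    have k := haz a ha z ha1 ha2 hz1 hz2
    rwa [jordanDefect_apply, mul_eq_zero_of_orthogonal hz2 ha1 h.QP,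
      mul_eq_zero_of_orthogonal (dz2 z hz1 hz2) ha1 h.QP,
      mul_eq_zero_of_orthogonal hz2 (da a ha ha1 ha2).1 h.QP, add_zero, add_zero, add_zero,
      sub_eq_zero] at k
  have Ezb : ∀ z, ∀ b ∈ S, P * z = z → z * Q = z → Q * b = b → b * Q = b →
      δ (z * b) = δ z * b + z * δ b := by
    intro z b hb hz1 hz2 hb1 hb2
    have k := hzb b hb z hb1 hb2 hz1 hz2
    rwa [jordanDefect_apply, mul_eq_zero_of_orthogonal hb2 hz1 h.QP,
      mul_eq_zero_of_orthogonal hb2 (dz1 z hz1 hz2) h.QP,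
      mul_eq_zero_of_orthogonal (db b hb hb1 hb2).2 hz1 h.QP, add_zero, add_zero, add_zero,
      sub_eq_zero] at k
  have Eaa : ∀ a ∈ S, ∀ c ∈ S, P * a = a → a * P = a → P * c = c → c * P = c →
      δ (a * c) = δ a * c + a * δ c := by
    intro a ha c hc ha1 ha2 hc1 hc2
    have hac := S.mul_mem ha hc
    have hac1 : P * (a * c) = a * c := by rw [← mul_assoc, ha1]
    have hac2 : a * c * P = a * c := by rw [mul_assoc, hc2]
    refine sub_eq_zero.1 (h.eq_zero_of_mul_upper ?_ fun z hz1 hz2 => ?_)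
    · rw [sub_mul, add_mul, (da _ hac hac1 hac2).2, mul_assoc, hc2, mul_assoc,
        (da c hc hc1 hc2).2]
    · have k1 := Eaz _ hac z hac1 hac2 hz1 hz2
      have k2 := Eaz a ha (c * z) ha1 ha2 (by rw [← mul_assoc, hc1]) (by rw [mul_assoc, hz2])
      rw [← mul_assoc, k1, Eaz c hc z hc1 hc2 hz1 hz2] at k2
      rw [sub_mul, add_mul, eq_sub_of_add_eq k2]
      noncomm_ring
  have Ebb : ∀ a ∈ S, ∀ c ∈ S, Q * a = a → a * Q = a → Q * c = c → c * Q = c →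
      δ (a * c) = δ a * c + a * δ c := by
    intro a ha c hc ha1 ha2 hc1 hc2
    have hac := S.mul_mem ha hc
    have hac1 : Q * (a * c) = a * c := by rw [← mul_assoc, ha1]
    have hac2 : a * c * Q = a * c := by rw [mul_assoc, hc2]
    refine sub_eq_zero.1 (h.eq_zero_of_upper_mul ?_ fun z hz1 hz2 => ?_)
    · rw [mul_sub, mul_add, (db _ hac hac1 hac2).1, ← mul_assoc, ← mul_assoc, ha1,
        (db a ha ha1 ha2).1]
    · have k1 := Ezb z _ hac hz1 hz2 hac1 hac2
      have k2 := Ezb (z * a) c hc (by rw [← mul_assoc, hz1]) (by rw [mul_assoc, ha2]) hc1 hc2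
      rw [mul_assoc, k1, Ezb z a ha hz1 hz2 ha1 ha2] at k2
      rw [mul_sub, mul_add, eq_sub_of_add_eq' k2]
      noncomm_ring
  have parts : ∀ r ∈ S, ∃ a ∈ S, ∃ z, ∃ b ∈ S, r = a + z + b ∧ P * a = a ∧ a * P = a ∧
      P * z = z ∧ z * Q = z ∧ Q * b = b ∧ b * Q = b := by
    intro r hr
    refine ⟨P * r * P, S.mul_mem (S.mul_mem h.P_mem hr) h.P_mem, P * r * Q, Q * r * Q,
      S.mul_mem (S.mul_mem h.Q_mem hr) h.Q_mem, ?_, ?_⟩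
    · conv_lhs => rw [h.peirce r, h.lower r hr, add_zero]
    · simp only [mul_assoc, h.PP, h.QQ, h.PP_mul, h.QQ_mul, and_self]
  obtain ⟨a, ha, z, b, hb, rfl, ha1, ha2, hz1, hz2, hb1, hb2⟩ := parts s hs
  obtain ⟨a', ha', z', b', hb', rfl, ha1', ha2', hz1', hz2', hb1', hb2'⟩ := parts t ht
  obtain ⟨ea1, ea2⟩ := da a ha ha1 ha2
  obtain ⟨eb1, eb2⟩ := db b hb hb1 hb2
  obtain ⟨ea1', ea2'⟩ := da a' ha' ha1' ha2'
  obtain ⟨eb1', eb2'⟩ := db b' hb' hb1' hb2'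
  have ez1 := dz1 z hz1 hz2
  have ez2 := dz2 z hz1 hz2
  have ez1' := dz1 z' hz1' hz2'
  have ez2' := dz2 z' hz1' hz2'
  have o := h.PQ
  have o' := h.QP
  simp only [mul_add, add_mul, map_add, Eaa a ha a' ha' ha1 ha2 ha1' ha2',
    Eaz a ha z' ha1 ha2 hz1' hz2', Ezb z b' hb' hz1 hz2 hb1' hb2', Ebb b hb b' hb' hb1 hb2 hb1' hb2',
    mul_eq_zero_of_orthogonal ha2 hb1' o, mul_eq_zero_of_orthogonal hz2 ha1' o',
    mul_eq_zero_of_orthogonal hz2 hz1' o', mul_eq_zero_of_orthogonal hb2 ha1' o',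
    mul_eq_zero_of_orthogonal hb2 hz1' o',
    mul_eq_zero_of_orthogonal ea2 hb1' o, mul_eq_zero_of_orthogonal ez2 ha1' o',
    mul_eq_zero_of_orthogonal ez2 hz1' o', mul_eq_zero_of_orthogonal eb2 ha1' o',
    mul_eq_zero_of_orthogonal eb2 hz1' o',
    mul_eq_zero_of_orthogonal ha2 eb1' o, mul_eq_zero_of_orthogonal hz2 ea1' o',
    mul_eq_zero_of_orthogonal hz2 ez1' o', mul_eq_zero_of_orthogonal hb2 ea1' o',
    mul_eq_zero_of_orthogonal hb2 ez1' o', add_zero, zero_add]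
  abel

/-- Subtracting an inner derivation does not change the Jordan defect. -/
theorem _root_.jordanDefect_sub_inner (δ : R →ₗ[ℂ] R) (T a b : R) :
    jordanDefect (δ - (LinearMap.mulLeft ℂ T - LinearMap.mulRight ℂ T)) a b
      = jordanDefect δ a b := by
  simp only [jordanDefect_apply, LinearMap.sub_apply, LinearMap.mulLeft_apply,
    LinearMap.mulRight_apply]
  noncomm_ring

/-- A linear map which is Jordan derivable at one point of a triangular subalgebra is a
derivation. -/
theorem derivation_of_jordanDefect_eq_zero (h : TriangularPair S P Q) {δ : R →ₗ[ℂ] R} {C : R}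
    (hC : C ∈ S) (hδ : ∀ a ∈ S, ∀ b ∈ S, a * b = C → jordanDefect δ a b = 0)
    {s t : R} (hs : s ∈ S) (ht : t ∈ S) : δ (s * t) = δ s * t + s * δ t := by
  have hup := fun z hz1 hz2 => h.jordanDefect_P_upper hC hδ (z := z) hz1 hz2
  have hcor : ∀ {a b z}, _ := fun {a b z} => h.jordanDefect_corners hC hδ (a := a) (b := b) (z := z)
  have z0 : P * (0 : R) = 0 := mul_zero P
  have z1 : (0 : R) * Q = 0 := zero_mul Q
  have hPQ := (hcor h.P_mem h.Q_mem h.PP h.PP h.QQ h.QQ z0 z1).1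
  have hzQ : ∀ z, P * z = z → z * Q = z → jordanDefect δ z Q = 0 := by
    intro z hz1 hz2
    have k := (hcor h.P_mem h.Q_mem h.PP h.PP h.QQ h.QQ hz1 hz2).2.1
    rwa [hz1, hz2, hup z hz1 hz2] at k
  obtain ⟨d1, d2, d3, d4⟩ := h.diag_of_jordanDefect_P_Q hPQ
  have hu : ∀ z, P * z = z → z * Q = z → P * δ P * P * z = 0 := by
    intro z hz1 hz2
    have hzP : z * P = 0 := mul_eq_zero_of_orthogonal hz2 h.PP h.QP
    have k := hup z hz1 hz2
    rw [jordanDefect_apply, hz1, hzP, add_zero] at k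
    have k' := congrArg (P * · * Q) k
    have e : z * (δ P * Q) = 0 := by rw [← hz2, mul_assoc, ← mul_assoc Q, d2, mul_zero]
    simp only [mul_add, add_mul, mul_sub, sub_mul, mul_assoc, h.PQ, h.PP_mul, mul_zero, zero_mul,
      add_zero, hz2, e] at k'
    simp only [mul_assoc, hz1]
    rwa [sub_add_cancel_right, neg_eq_zero] at k'
  have d5 : P * δ P * P = 0 :=
    h.eq_zero_of_mul_upper (by simp only [mul_assoc, h.PP]) hu
  have d6 : Q * δ Q * Q = 0 := by
    refine h.eq_zero_of_upper_mul (by simp only [mul_assoc, h.QQ_mul]) fun z hz1 hz2 => ?_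
    rw [← h.intertwine_of_jordanDefect hPQ hz1 hz2 (by rw [hzQ z hz1 hz2, hup z hz1 hz2]),
      hu z hz1 hz2]
  set T : R := Q * δ P * P - P * δ P * Q with hT
  set δ' := δ - (LinearMap.mulLeft ℂ T - LinearMap.mulRight ℂ T) with hδ'
  have app : ∀ r, δ' r = δ r - (T * r - r * T) := fun r => rfl
  have hD : ∀ a b, jordanDefect δ' a b = jordanDefect δ a b := jordanDefect_sub_inner δ T
  have h1 : δ P + δ Q = 0 := by
    rw [h.peirce (δ P + δ Q), d3, d4]
    simp only [mul_add, add_mul, d1, d2, d5, d6, add_zero]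
  have hP0 : δ' P = 0 := by
    rw [app, sub_eq_zero]
    conv_lhs => rw [h.peirce (δ P), d5, d2]
    simp only [hT, mul_sub, sub_mul, mul_assoc, h.PP, h.QP, h.PP_mul, h.PQ_mul, mul_zero]
    abel
  have hQ0 : δ' Q = 0 := by
    have e : δ' P + δ' Q = 0 := by
      rw [← map_add, h.add_eq, app, ← h.add_eq, map_add, h1, h.add_eq]; simp
    rwa [hP0, zero_add] at e
  have key := h.derivation_of_map_idempotents_eq_zero hP0 hQ0
    (fun a ha b hb ha1 ha2 hb1 hb2 => by
      rw [hD]; exact (hcor ha hb ha1 ha2 hb1 hb2 z0 z1).1)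
    (fun a ha z ha1 ha2 hz1 hz2 => by
      have k := (hcor ha h.Q_mem ha1 ha2 h.QQ h.QQ hz1 hz2).2.1
      rw [hz2, hzQ (a * z) (by rw [← mul_assoc, ha1]) (by rw [mul_assoc, hz2])] at k
      rw [hD, ← k])
    (fun b hb z hb1 hb2 hz1 hz2 => by
      have k := (hcor h.P_mem hb h.PP h.PP hb1 hb2 hz1 hz2).2.1
      rw [hz1, hup (z * b) (by rw [← mul_assoc, hz1]) (by rw [mul_assoc, hb2])] at k
      rw [hD, k])
    (fun z hz1 hz2 => by
      rw [hD]; exact (hcor h.P_mem h.Q_mem h.PP h.PP h.QQ h.QQ hz1 hz2).2.2) hs ht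
  rw [app, app, app] at key
  rw [eq_add_of_sub_eq key]
  noncomm_ring

end TriangularPair

end Peirce

theorem eq_zero_or_eq_zero_of_mul_mul_eq_zero {X : Type*} [NormedAddCommGroup X]
    [NormedSpace ℂ X] {s t : X →L[ℂ] X} (h : ∀ r, s * r * t = 0) : s = 0 ∨ t = 0 := by
  by_contra! hst
  obtain ⟨⟨x, hx⟩, ⟨y, hy⟩⟩ := And.imp DFunLike.ne_iff.1 DFunLike.ne_iff.1 hst
  obtain ⟨φ, hφ⟩ := SeparatingDual.exists_ne_zero (R := ℂ) hy
  have := DFunLike.congr_fun (h (φ.smulRight x)) y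
  simp [hφ] at this
  exact hx this

theorem isClosed_algLat {X : Type*} [NormedAddCommGroup X] [NormedSpace ℂ X]
    (ℒ : Set (Submodule ℂ X)) (hcl : ∀ K ∈ ℒ, IsClosed (K : Set X)) :
    IsClosed (algLat ℒ : Set (X →L[ℂ] X)) := by
  have : (algLat ℒ : Set (X →L[ℂ] X)) = ⋂ K ∈ ℒ, ⋂ x ∈ K, {T | T x ∈ (K : Set X)} := by
    ext T
    simp only [Set.mem_iInter, Set.mem_ofPred_eq]
    rfl
  rw [this]
  exact isClosed_biInter fun K hK => isClosed_biInter fun x _ =>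
    (hcl K hK).preimage (ContinuousLinearMap.apply ℂ X x).continuous

theorem exists_add_smul_unit_algLat {X : Type*} [NormedAddCommGroup X] [NormedSpace ℂ X]
    [CompleteSpace X] (ℒ : Set (Submodule ℂ X)) (hcl : ∀ K ∈ ℒ, IsClosed (K : Set X)) :
    ∀ s ∈ algLat ℒ, ∃ k : ℂ, ∃ t ∈ algLat ℒ,
      (s + k • (1 : X →L[ℂ] X)) * t = 1 ∧ t * (s + k • (1 : X →L[ℂ] X)) = 1 := by
  intro s hs
  have : CompleteSpace (algLat ℒ) := (isClosed_algLat ℒ hcl).completeSpace_coe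
  obtain ⟨k, hk⟩ : ∃ k : ℂ, k ∉ spectrum ℂ (-⟨s, hs⟩ : algLat ℒ) := by
    by_contra! hk
    have hb := (spectrum.isBounded (𝕜 := ℂ) (-⟨s, hs⟩ : algLat ℒ))
    rw [Set.eq_univ_of_forall hk] at hb
    exact NormedSpace.noncompactSpace ℂ ℂ |>.noncompact_univ
      (Metric.isCompact_of_isClosed_isBounded isClosed_univ hb)
  rw [spectrum.notMem_iff] at hk
  obtain ⟨u, hu⟩ := hk
  have hu' : ((u : algLat ℒ) : X →L[ℂ] X) = s + k • (1 : X →L[ℂ] X) := by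
    rw [hu, sub_neg_eq_add, Algebra.algebraMap_eq_smul_one, add_comm]; rfl
  refine ⟨k, ((u⁻¹ : (algLat ℒ)ˣ) : algLat ℒ), SetLike.coe_mem _, ?_, ?_⟩
  · rw [← hu']; exact congrArg Subtype.val u.mul_inv
  · rw [← hu']; exact congrArg Subtype.val u.inv_mul

/-- let `ℒ` be a subspace lattice on a complex Banach space `X` and
`𝒜 = alg ℒ`. If there is a nontrivial idempotent `P ∈ 𝒜` with `ran(P) ∈ ℒ` and
`P B(X) (I − P) ⊆ 𝒜`, then every linear map `δ : 𝒜 → B(X)` which is Jordan derivable at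
some `C ∈ 𝒜` is a derivation; in particular every `C ∈ 𝒜` is a Jordan all-derivable point
of `L(𝒜, B(X))`. -/
theorem statement6 {X : Type*} [NormedAddCommGroup X] [NormedSpace ℂ X] [CompleteSpace X]
    -- `ℒ` is a subspace lattice: a family of closed subspaces containing `(0)` and `X`,
    -- closed under arbitrary intersections and closed linear spans
    (ℒ : Set (Submodule ℂ X))
    (hcl : ∀ K ∈ ℒ, IsClosed (K : Set X))
    (hbot : ⊥ ∈ ℒ) (htop : ⊤ ∈ ℒ)
    (hinf : ∀ S ⊆ ℒ, sInf S ∈ ℒ)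
    (hsup : ∀ S ⊆ ℒ, (sSup S).topologicalClosure ∈ ℒ)
    -- a nontrivial idempotent `P ∈ alg ℒ` with `ran(P) ∈ ℒ` and `P B(X) (I − P) ⊆ alg ℒ`
    (P : X →L[ℂ] X) (hPmem : P ∈ algLat ℒ)
    (hP : P * P = P) (hP0 : P ≠ 0) (hP1 : P ≠ 1)
    (hran : LinearMap.range (P : X →ₗ[ℂ] X) ∈ ℒ)
    (hPBQ : ∀ T : X →L[ℂ] X, P * T * (1 - P) ∈ algLat ℒ)
    -- `δ` is Jordan derivable at `C ∈ alg ℒ`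
    (C : algLat ℒ) (δ : (algLat ℒ) →ₗ[ℂ] (X →L[ℂ] X))
    (hδ : ∀ a b : algLat ℒ, a * b = C →
      δ (a * b + b * a) = δ a * (b : X →L[ℂ] X) + (a : X →L[ℂ] X) * δ b
        + δ b * (a : X →L[ℂ] X) + (b : X →L[ℂ] X) * δ a) :
    -- `δ` is a derivation
    ∀ a b : algLat ℒ, δ (a * b) = δ a * (b : X →L[ℂ] X) + (a : X →L[ℂ] X) * δ b := by
  have htri : TriangularPair (algLat ℒ) P (1 - P) :=
    { add_eq := add_sub_cancel _ _
      PP := hP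
      P_ne := hP0
      Q_ne := sub_ne_zero.2 hP1.symm
      P_mem := hPmem
      lower := by
        intro s hs
        ext x
        obtain ⟨y, hy⟩ := hs _ hran (P x) ⟨x, rfl⟩
        have hy' : P y = s (P x) := hy
        have hPy : P (P y) = P y := DFunLike.congr_fun hP y
        simp [← hy', hPy]
      upper := hPBQ
      prime := fun _ _ => eq_zero_or_eq_zero_of_mul_mul_eq_zero
      unit := exists_add_smul_unit_algLat ℒ hcl }
  obtain ⟨Δ, hΔ⟩ := LinearMap.exists_extend (p := Subalgebra.toSubmodule (algLat ℒ)) δ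
  have hΔ' : ∀ a : algLat ℒ, Δ a = δ a := fun a => DFunLike.congr_fun hΔ a
  intro a b
  have key := htri.derivation_of_jordanDefect_eq_zero (δ := Δ) C.2 (fun a ha b hb hab => by
    have := hδ ⟨a, ha⟩ ⟨b, hb⟩ (Subtype.ext hab)
    rw [← hΔ', ← hΔ', ← hΔ'] at this
    rw [jordanDefect_apply, sub_eq_zero]
    exact this) a.2 b.2
  rw [hΔ', hΔ'] at key
  rw [← key, ← hΔ', MulMemClass.coe_mul]
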